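/- Powers of positive sub-solutions are sub-solutions: let d ≥ 1, 0 < λ ≤ Λ, let A be smooth and uniformly elliptic with constants λ, Λ, let U ⊂ ℝ^d × ℝ^d × ℝ be open, and let f be a classical sub-solution of ∂_t f + v·∇_x f ≤ ∇_v·(A ∇_v f) on U with f > 0 on U. Then for every q > 1 the function f^q is again a classical sub-solution on U: ∂_t(f^q) + v·∇_x(f^q) ≤ ∇_v·(A ∇_v (f^q)) pointwise on U. -/

import Mathlib

open MeasureTheory Set

noncomputable section

/-- Points of phase space-time: `(x, v, t)`. -/
abbrev KPt (d : ℕ) := EuclideanSpace ℝ (Fin d) × EuclideanSpace ℝ (Fin d) × ℝ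

/-- Kinetic cylinder `Q_r(z₀) = B_{r³}(x₀) × B_r(v₀) × (t₀ - r², t₀]`. -/
def kCyl (d : ℕ) (r : ℝ) (z₀ : KPt d) : Set (KPt d) :=
  {p | p.1 ∈ Metric.ball z₀.1 (r ^ 3) ∧ p.2.1 ∈ Metric.ball z₀.2.1 r ∧
    p.2.2 ∈ Set.Ioc (z₀.2.2 - r ^ 2) z₀.2.2}

/-- Time derivative `∂_t f`. -/
def tDeriv {d : ℕ} (f : EuclideanSpace ℝ (Fin d) → EuclideanSpace ℝ (Fin d) → ℝ → ℝ)
    (x v : EuclideanSpace ℝ (Fin d)) (t : ℝ) : ℝ :=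
  deriv (fun s => f x v s) t

/-- `i`-th component of the spatial gradient `∇_x f`. -/
def gradX {d : ℕ} (f : EuclideanSpace ℝ (Fin d) → EuclideanSpace ℝ (Fin d) → ℝ → ℝ)
    (x v : EuclideanSpace ℝ (Fin d)) (t : ℝ) (i : Fin d) : ℝ :=
  fderiv ℝ (fun y => f y v t) x (EuclideanSpace.single i 1)

/-- `i`-th component of the velocity gradient `∇_v f`. -/
def gradV {d : ℕ} (f : EuclideanSpace ℝ (Fin d) → EuclideanSpace ℝ (Fin d) → ℝ → ℝ)
    (x v : EuclideanSpace ℝ (Fin d)) (t : ℝ) (i : Fin d) : ℝ :=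
  fderiv ℝ (fun w => f x w t) v (EuclideanSpace.single i 1)

/-- Squared norm of the velocity gradient, `|∇_v f|²`. -/
def gradVSq {d : ℕ} (f : EuclideanSpace ℝ (Fin d) → EuclideanSpace ℝ (Fin d) → ℝ → ℝ)
    (x v : EuclideanSpace ℝ (Fin d)) (t : ℝ) : ℝ :=
  ∑ i, (gradV f x v t i) ^ 2

/-- Divergence in `v` of `A ∇_v f`, i.e. `∇_v · (A(x,v,t) ∇_v f)`. -/
def divAGradV {d : ℕ}
    (A : EuclideanSpace ℝ (Fin d) → EuclideanSpace ℝ (Fin d) → ℝ → Matrix (Fin d) (Fin d) ℝ)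
    (f : EuclideanSpace ℝ (Fin d) → EuclideanSpace ℝ (Fin d) → ℝ → ℝ)
    (x v : EuclideanSpace ℝ (Fin d)) (t : ℝ) : ℝ :=
  ∑ i, fderiv ℝ (fun w => ∑ j, A x w t i j * gradV f x w t j) v (EuclideanSpace.single i 1)

/-- `A` is smooth, symmetric, and uniformly elliptic with constants `0 < lam ≤ Lam`. -/
def IsUnifElliptic {d : ℕ} (lam Lam : ℝ)
    (A : EuclideanSpace ℝ (Fin d) → EuclideanSpace ℝ (Fin d) → ℝ → Matrix (Fin d) (Fin d) ℝ) :
    Prop :=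
  (∀ x v t i j, A x v t i j = A x v t j i) ∧
  (∀ i j, ContDiff ℝ (⊤ : ℕ∞) (fun p : KPt d => A p.1 p.2.1 p.2.2 i j)) ∧
  (∀ x v t (ξ : Fin d → ℝ),
    lam * ∑ i, ξ i ^ 2 ≤ ∑ i, ∑ j, ξ i * A x v t i j * ξ j ∧
    ∑ i, ∑ j, ξ i * A x v t i j * ξ j ≤ Lam * ∑ i, ξ i ^ 2)

/-- `f` is a classical (C^∞) solution of `∂_t f + v·∇_x f = ∇_v·(A ∇_v f)` on `U`. -/
def IsKFPSolution {d : ℕ}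
    (A : EuclideanSpace ℝ (Fin d) → EuclideanSpace ℝ (Fin d) → ℝ → Matrix (Fin d) (Fin d) ℝ)
    (f : EuclideanSpace ℝ (Fin d) → EuclideanSpace ℝ (Fin d) → ℝ → ℝ) (U : Set (KPt d)) : Prop :=
  ContDiffOn ℝ (⊤ : ℕ∞) (fun p : KPt d => f p.1 p.2.1 p.2.2) U ∧
  ∀ p ∈ U, tDeriv f p.1 p.2.1 p.2.2 + ∑ i, (p.2.1 : EuclideanSpace ℝ (Fin d)) i * gradX f p.1 p.2.1 p.2.2 i
    = divAGradV A f p.1 p.2.1 p.2.2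

/-- `f` is a classical (C^∞) sub-solution of `∂_t f + v·∇_x f ≤ ∇_v·(A ∇_v f)` on `U`. -/
def IsKFPSubSolution {d : ℕ}
    (A : EuclideanSpace ℝ (Fin d) → EuclideanSpace ℝ (Fin d) → ℝ → Matrix (Fin d) (Fin d) ℝ)
    (f : EuclideanSpace ℝ (Fin d) → EuclideanSpace ℝ (Fin d) → ℝ → ℝ) (U : Set (KPt d)) : Prop :=
  ContDiffOn ℝ (⊤ : ℕ∞) (fun p : KPt d => f p.1 p.2.1 p.2.2) U ∧
  ∀ p ∈ U, tDeriv f p.1 p.2.1 p.2.2 + ∑ i, (p.2.1 : EuclideanSpace ℝ (Fin d)) i * gradX f p.1 p.2.1 p.2.2 i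
    ≤ divAGradV A f p.1 p.2.1 p.2.2

/-- A smooth function on an open set of phase space-time is smooth in the velocity variable. -/
theorem contDiffAt_velocity {d : ℕ} {U : Set (KPt d)} (hU : IsOpen U)
    {f : EuclideanSpace ℝ (Fin d) → EuclideanSpace ℝ (Fin d) → ℝ → ℝ}
    (hf : ContDiffOn ℝ (⊤ : ℕ∞) (fun p : KPt d => f p.1 p.2.1 p.2.2) U)
    {x v : EuclideanSpace ℝ (Fin d)} {t : ℝ} (hp : (x, v, t) ∈ U) :
    ContDiffAt ℝ (⊤ : ℕ∞) (fun w => f x w t) v := by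
  have h := hf.contDiffAt (hU.mem_nhds hp)
  have hg : ContDiff ℝ (⊤ : ℕ∞) (fun w : EuclideanSpace ℝ (Fin d) => ((x, w, t) : KPt d)) := by
    fun_prop
  exact ContDiffAt.comp (g := fun p : KPt d => f p.1 p.2.1 p.2.2) v h hg.contDiffAt

theorem differentiableAt_gradV {d : ℕ}
    {f : EuclideanSpace ℝ (Fin d) → EuclideanSpace ℝ (Fin d) → ℝ → ℝ}
    {x v : EuclideanSpace ℝ (Fin d)} {t : ℝ}
    (hf : ContDiffAt ℝ (⊤ : ℕ∞) (fun w => f x w t) v) (j : Fin d) :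
    DifferentiableAt ℝ (fun w => gradV f x w t j) v := by
  have h : ContDiffAt ℝ 1 (fderiv ℝ (fun w => f x w t)) v :=
    hf.fderiv_right (by norm_cast)
  exact (h.differentiableAt one_ne_zero).clm_apply (differentiableAt_const _)

theorem gradV_rpow {d : ℕ}
    {f : EuclideanSpace ℝ (Fin d) → EuclideanSpace ℝ (Fin d) → ℝ → ℝ}
    {x v : EuclideanSpace ℝ (Fin d)} {t q : ℝ}
    (hf : DifferentiableAt ℝ (fun w => f x w t) v) (hpos : 0 < f x v t) (j : Fin d) :
    gradV (fun x v t => f x v t ^ q) x v t j = q * f x v t ^ (q - 1) * gradV f x v t j := by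
  simp [gradV, (hf.hasFDerivAt.rpow_const (p := q) (Or.inl hpos.ne')).fderiv]

theorem gradX_rpow {d : ℕ}
    {f : EuclideanSpace ℝ (Fin d) → EuclideanSpace ℝ (Fin d) → ℝ → ℝ}
    {x v : EuclideanSpace ℝ (Fin d)} {t q : ℝ}
    (hf : DifferentiableAt ℝ (fun y => f y v t) x) (hpos : 0 < f x v t) (j : Fin d) :
    gradX (fun x v t => f x v t ^ q) x v t j = q * f x v t ^ (q - 1) * gradX f x v t j := by
  simp [gradX, (hf.hasFDerivAt.rpow_const (p := q) (Or.inl hpos.ne')).fderiv]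

theorem tDeriv_rpow {d : ℕ}
    {f : EuclideanSpace ℝ (Fin d) → EuclideanSpace ℝ (Fin d) → ℝ → ℝ}
    {x v : EuclideanSpace ℝ (Fin d)} {t q : ℝ}
    (hf : DifferentiableAt ℝ (fun s => f x v s) t) (hpos : 0 < f x v t) :
    tDeriv (fun x v t => f x v t ^ q) x v t = q * f x v t ^ (q - 1) * tDeriv f x v t := by
  have h := (hf.hasDerivAt.rpow_const (p := q) (Or.inl hpos.ne')).deriv
  rw [tDeriv, tDeriv, h]
  ring

/-- Chain rule for the diffusion operator applied to a power of a positive function. -/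
theorem divAGradV_rpow {d : ℕ} {U : Set (KPt d)} (hU : IsOpen U)
    {A : EuclideanSpace ℝ (Fin d) → EuclideanSpace ℝ (Fin d) → ℝ → Matrix (Fin d) (Fin d) ℝ}
    {f : EuclideanSpace ℝ (Fin d) → EuclideanSpace ℝ (Fin d) → ℝ → ℝ}
    (hf : ContDiffOn ℝ (⊤ : ℕ∞) (fun p : KPt d => f p.1 p.2.1 p.2.2) U)
    (hpos : ∀ p ∈ U, 0 < f p.1 p.2.1 p.2.2)
    {x v : EuclideanSpace ℝ (Fin d)} {t q : ℝ} (hp : (x, v, t) ∈ U)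
    (hA : ∀ i j, DifferentiableAt ℝ (fun w => A x w t i j) v) :
    divAGradV A (fun x v t => f x v t ^ q) x v t =
      q * f x v t ^ (q - 1) * divAGradV A f x v t +
        q * (q - 1) * f x v t ^ (q - 2) *
          ∑ i, ∑ j, gradV f x v t i * A x v t i j * gradV f x v t j := by
  have hd := (contDiffAt_velocity hU hf hp).differentiableAt (by simp)
  have hU' : ∀ᶠ w in nhds v, (x, w, t) ∈ U :=
    (show Continuous fun w : EuclideanSpace ℝ (Fin d) => ((x, w, t) : KPt d) by
      fun_prop).continuousAt.eventually_mem (hU.mem_nhds hp)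
  have key (i : Fin d) :
      fderiv ℝ (fun w => ∑ j, A x w t i j * gradV (fun x v t => f x v t ^ q) x w t j) v
          (EuclideanSpace.single i 1) =
        q * f x v t ^ (q - 1) *
          fderiv ℝ (fun w => ∑ j, A x w t i j * gradV f x w t j) v (EuclideanSpace.single i 1) +
        q * (q - 1) * f x v t ^ (q - 2) *
          ∑ j, gradV f x v t i * A x v t i j * gradV f x v t j := by
    have heq : (fun w => ∑ j, A x w t i j * gradV (fun x v t => f x v t ^ q) x w t j)
        =ᶠ[nhds v] fun w => (q * f x w t ^ (q - 1)) * ∑ j, A x w t i j * gradV f x w t j := by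
      filter_upwards [hU'] with w hw
      rw [Finset.mul_sum]
      refine Finset.sum_congr rfl fun j _ => ?_
      rw [gradV_rpow ((contDiffAt_velocity hU hf hw).differentiableAt (by simp)) (hpos _ hw)]
      ring
    have hflux : DifferentiableAt ℝ (fun w => ∑ j, A x w t i j * gradV f x w t j) v :=
      DifferentiableAt.fun_sum fun j _ =>
        (hA i j).mul (differentiableAt_gradV (contDiffAt_velocity hU hf hp) j)
    have hpow := (hd.hasFDerivAt.rpow_const (p := q - 1) (Or.inl (hpos _ hp).ne')).const_mul q
    have hsum : ∑ j, gradV f x v t i * A x v t i j * gradV f x v t j =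
        gradV f x v t i * ∑ j, A x v t i j * gradV f x v t j := by
      simp only [Finset.mul_sum, mul_assoc]
    rw [heq.fderiv_eq, (hpow.fun_mul hflux.hasFDerivAt).fderiv, hsum,
      show q - 2 = q - 1 - 1 by ring]
    simp only [add_apply, smul_apply, smul_eq_mul]
    rw [show gradV f x v t i = fderiv ℝ (fun w => f x w t) v (EuclideanSpace.single i 1) from rfl]
    ring
  simp only [divAGradV, key, Finset.sum_add_distrib, ← Finset.mul_sum]

/-- powers `f^q`, `q > 1`, of positive sub-solutions are sub-solutions. -/
theorem power_of_subsolution (d : ℕ) (hd : 1 ≤ d) (lam Lam : ℝ) (hlam : 0 < lam)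
    (hLam : lam ≤ Lam)
    (A : EuclideanSpace ℝ (Fin d) → EuclideanSpace ℝ (Fin d) → ℝ →
      Matrix (Fin d) (Fin d) ℝ)
    (hA : IsUnifElliptic lam Lam A) (U : Set (KPt d)) (hU : IsOpen U)
    (f : EuclideanSpace ℝ (Fin d) → EuclideanSpace ℝ (Fin d) → ℝ → ℝ)
    (hf : IsKFPSubSolution A f U) (hpos : ∀ p ∈ U, 0 < f p.1 p.2.1 p.2.2)
    (q : ℝ) (hq : 1 < q) :
    IsKFPSubSolution A (fun x v t => f x v t ^ q) U := by
  obtain ⟨hsm, hsub⟩ := hf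
  refine ⟨hsm.rpow_const_of_ne fun p hp => (hpos p hp).ne', ?_⟩
  rintro ⟨x, v, t⟩ hp
  have hF := (hsm.contDiffAt (hU.mem_nhds hp)).differentiableAt (by simp)
  have hx : DifferentiableAt ℝ (fun y => f y v t) x :=
    DifferentiableAt.comp (g := fun p : KPt d => f p.1 p.2.1 p.2.2)
      (f := fun y => ((y, v, t) : KPt d)) x hF (by fun_prop)
  have ht : DifferentiableAt ℝ (fun s => f x v s) t :=
    DifferentiableAt.comp (g := fun p : KPt d => f p.1 p.2.1 p.2.2)
      (f := fun s => ((x, v, s) : KPt d)) t hF (by fun_prop)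
  have hAd (i j : Fin d) : DifferentiableAt ℝ (fun w => A x w t i j) v :=
    (contDiffAt_velocity (f := fun x v t => A x v t i j) isOpen_univ (hA.2.1 i j).contDiffOn
      (mem_univ (x, v, t))).differentiableAt (by simp)
  have hfp : 0 < f x v t := hpos _ hp
  have hquad : 0 ≤ ∑ i, ∑ j, gradV f x v t i * A x v t i j * gradV f x v t j :=
    (mul_nonneg hlam.le (Finset.sum_nonneg fun i _ => sq_nonneg _)).trans
      (hA.2.2 x v t (gradV f x v t)).1
  have hq1 : 0 < q - 1 := sub_pos.2 hq
  have hq0 : 0 < q := one_pos.trans hq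
  have hmain := mul_le_mul_of_nonneg_left (hsub _ hp)
    (show 0 ≤ q * f x v t ^ (q - 1) by positivity)
  have hrest : 0 ≤ q * (q - 1) * f x v t ^ (q - 2) *
      ∑ i, ∑ j, gradV f x v t i * A x v t i j * gradV f x v t j := by positivity
  have htrans : ∑ i, v i * gradX (fun x v t => f x v t ^ q) x v t i =
      q * f x v t ^ (q - 1) * ∑ i, v i * gradX f x v t i := by
    rw [Finset.mul_sum]
    refine Finset.sum_congr rfl fun i _ => ?_
    rw [gradX_rpow hx hfp]
    ring
  dsimp only at hmain ⊢
  rw [tDeriv_rpow ht hfp, htrans, divAGradV_rpow hU hsm hpos hp hAd]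
  linarith

end
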